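/- For every composite positive integer n (i.e., n > 1 and n is not prime), there exists a polynomial f(x) ∈ ℚ[x] of degree n that is irreducible over ℚ but is reducible over the field ℚ_p of p-adic numbers for every prime p. -/

import Mathlib

open Polynomial

theorem PadicInt.toZMod_eq_zero_iff_dvd {p : ℕ} [Fact p.Prime] (x : ℤ_[p]) :
    PadicInt.toZMod x = 0 ↔ (p : ℤ_[p]) ∣ x := by
  rw [← RingHom.mem_ker, PadicInt.ker_toZMod, PadicInt.maximalIdeal_eq_span_p,
    Ideal.mem_span_singleton]

theorem PadicInt.C_dvd_of_map_toZMod_eq_zero {p : ℕ} [Fact p.Prime] {r : ℤ_[p][X]}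
    (h : r.map PadicInt.toZMod = 0) : C (p : ℤ_[p]) ∣ r := by
  rw [C_dvd_iff_dvd_coeff]
  intro i
  rw [← PadicInt.toZMod_eq_zero_iff_dvd, ← coeff_map, h, coeff_zero]

/-- Over a field, a Bézout relation between coprime monic polynomials can be solved within the
expected degrees. -/
theorem IsCoprime.exists_mul_add_mul_eq_of_degree_lt {k : Type*} [Field k] {u v r : k[X]}
    (hu : u.Monic) (hv : v.Monic) (huv : IsCoprime u v)
    (hr : r.degree < (u.natDegree + v.natDegree : ℕ)) :
    ∃ a b : k[X], a.degree < u.natDegree ∧ b.degree < v.natDegree ∧ a * v + b * u = r := by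
  obtain ⟨s, t, hst⟩ := huv
  have h1 := modByMonic_add_div (t * r) u
  set a := (t * r) %ₘ u with ha
  have hadeg : a.degree < u.natDegree := by
    rw [← degree_eq_natDegree hu.ne_zero]
    exact degree_modByMonic_lt _ hu
  refine ⟨a, s * r + (t * r) /ₘ u * v, hadeg, ?_, ?_⟩
  · set b := s * r + (t * r) /ₘ u * v
    have hb : b * u = r - a * v := by
      linear_combination r * hst + v * h1
    have hlt : (b * u).degree < (u.natDegree + v.natDegree : ℕ) := by
      rw [hb]
      refine (degree_sub_le _ _).trans_lt (max_lt hr ?_)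
      rw [hv.degree_mul, degree_eq_natDegree hv.ne_zero]
      push_cast
      exact WithBot.add_lt_add_right (by simp) hadeg
    rw [hu.degree_mul, degree_eq_natDegree hu.ne_zero] at hlt
    push_cast at hlt
    rw [add_comm] at hlt
    exact lt_of_add_lt_add_left hlt
  · linear_combination r * hst + v * h1

theorem PadicInt.exists_factorization_mod_pow {p : ℕ} [Fact p.Prime] {f : ℤ_[p][X]}
    (hf : f.Monic) {u v : (ZMod p)[X]} (hu : u.Monic) (hv : v.Monic) (huv : IsCoprime u v)
    (h : f.map PadicInt.toZMod = u * v) (n : ℕ) :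
    ∃ U V : ℤ_[p][X], U.Monic ∧ V.Monic ∧ U.natDegree = u.natDegree ∧
      V.natDegree = v.natDegree ∧ U.map PadicInt.toZMod = u ∧ V.map PadicInt.toZMod = v ∧
      C ((p : ℤ_[p]) ^ (n + 1)) ∣ f - U * V := by
  have hsurj : Function.Surjective (PadicInt.toZMod (p := p)) := ZMod.ringHom_surjective _
  have hfdeg : f.natDegree = u.natDegree + v.natDegree := by
    rw [← hf.natDegree_map PadicInt.toZMod, h, hu.natDegree_mul hv]
  induction n with
  | zero =>
    obtain ⟨U, hU, hUd, hUm⟩ := lifts_and_natDegree_eq_and_monic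
      (f := (PadicInt.toZMod (p := p))) (p := u) (map_surjective _ hsurj u) hu
    obtain ⟨V, hV, hVd, hVm⟩ := lifts_and_natDegree_eq_and_monic
      (f := (PadicInt.toZMod (p := p))) (p := v) (map_surjective _ hsurj v) hv
    refine ⟨U, V, hUm, hVm, hUd, hVd, hU, hV, ?_⟩
    rw [zero_add, pow_one]
    apply PadicInt.C_dvd_of_map_toZMod_eq_zero
    simp [hU, hV, h]
  | succ n ih =>
    obtain ⟨U, V, hUm, hVm, hUd, hVd, hU, hV, r, hr⟩ := ih
    have hp : (p : ℤ_[p]) ^ (n + 1) ≠ 0 :=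
      pow_ne_zero _ (Nat.cast_ne_zero.mpr (Fact.out : p.Prime).ne_zero)
    have hrdeg : r.degree < (u.natDegree + v.natDegree : ℕ) := by
      rw [← degree_C_mul hp, ← hr, ← hfdeg, ← degree_eq_natDegree hf.ne_zero]
      apply degree_sub_lt_left _ hf.ne_zero
      · rw [hf.leadingCoeff, (hUm.mul hVm).leadingCoeff]
      · rw [degree_eq_natDegree hf.ne_zero, degree_eq_natDegree (hUm.mul hVm).ne_zero,
          hUm.natDegree_mul hVm, hUd, hVd, hfdeg]
    obtain ⟨a, b, ha, hb, hab⟩ := huv.exists_mul_add_mul_eq_of_degree_lt hu hv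
      (r := r.map PadicInt.toZMod) (degree_map_le.trans_lt hrdeg)
    obtain ⟨A, hA, hAd⟩ := exists_degree_eq_of_mem_lifts
      (f := (PadicInt.toZMod (p := p))) (p := a) (map_surjective _ hsurj a)
    obtain ⟨B, hB, hBd⟩ := exists_degree_eq_of_mem_lifts
      (f := (PadicInt.toZMod (p := p))) (p := b) (map_surjective _ hsurj b)
    have hAlt : (C ((p : ℤ_[p]) ^ (n + 1)) * A).degree < U.degree := by
      rw [degree_eq_natDegree hUm.ne_zero, hUd]
      rwa [degree_C_mul hp, hAd]
    have hBlt : (C ((p : ℤ_[p]) ^ (n + 1)) * B).degree < V.degree := by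
      rw [degree_eq_natDegree hVm.ne_zero, hVd]
      rwa [degree_C_mul hp, hBd]
    obtain ⟨w, hw⟩ : C (p : ℤ_[p]) ∣ r - (A * V + B * U) := by
      apply PadicInt.C_dvd_of_map_toZMod_eq_zero
      simp [hA, hB, hU, hV, hab]
    refine ⟨U + C ((p : ℤ_[p]) ^ (n + 1)) * A, V + C ((p : ℤ_[p]) ^ (n + 1)) * B,
      hUm.add_of_left hAlt, hVm.add_of_left hBlt, ?_, ?_, ?_, ?_, ?_⟩
    · rw [natDegree_eq_of_degree_eq (degree_add_eq_left_of_degree_lt hAlt), hUd]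
    · rw [natDegree_eq_of_degree_eq (degree_add_eq_left_of_degree_lt hBlt), hVd]
    · simp [hU]
    · simp [hV]
    · refine ⟨w - C ((p : ℤ_[p]) ^ n) * A * B, ?_⟩
      simp only [map_pow] at hr ⊢
      linear_combination hr + C (p : ℤ_[p]) ^ (n + 1) * hw

/-- Hensel's lemma for factorizations: a coprime factorization modulo `p` of a monic polynomial
over `ℤ_[p]` lifts to `ℤ_[p]`. -/
theorem PadicInt.exists_factorization_of_isCoprime {p : ℕ} [Fact p.Prime] {f : ℤ_[p][X]}
    (hf : f.Monic) {u v : (ZMod p)[X]} (hu : u.Monic) (hv : v.Monic) (huv : IsCoprime u v)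
    (h : f.map PadicInt.toZMod = u * v) :
    ∃ U V : ℤ_[p][X], U.natDegree = u.natDegree ∧ V.natDegree = v.natDegree ∧ f = U * V := by
  let P (d : ℕ) (c : ℕ → ℤ_[p]) : ℤ_[p][X] := X ^ d + ∑ i ∈ Finset.range d, C (c i) * X ^ i
  have hP : ∀ d c, (P d c).natDegree = d := fun d c ↦ by
    apply natDegree_eq_of_degree_eq_some
    have hlt : (∑ i ∈ Finset.range d, C (c i) * X ^ i : ℤ_[p][X]).degree
        < (X ^ d : ℤ_[p][X]).degree := by
      rw [degree_X_pow, degree_lt_iff_coeff_zero]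
      intro m hm
      simp only [finsetSum_coeff, coeff_C_mul, coeff_X_pow]
      exact Finset.sum_eq_zero fun i hi ↦ by
        rw [if_neg (by have := Finset.mem_range.mp hi; omega), mul_zero]
    rw [degree_add_eq_left_of_degree_lt hlt, degree_X_pow]
  have hPc : ∀ d k, Continuous fun c ↦ (P d c).coeff k := fun d k ↦ by
    simp only [P, coeff_add, finsetSum_coeff, coeff_C_mul]
    fun_prop
  let φ (c : (ℕ → ℤ_[p]) × (ℕ → ℤ_[p])) (k : ℕ) : ℤ_[p] :=
    (f - P u.natDegree c.1 * P v.natDegree c.2).coeff k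
  have hφ : Continuous φ := by
    refine continuous_pi fun k ↦ ?_
    simp only [φ, coeff_sub, coeff_mul]
    refine continuous_const.sub (continuous_finsetSum _ fun i _ ↦ ?_)
    exact ((hPc _ _).comp continuous_fst).mul ((hPc _ _).comp continuous_snd)
  have hmem : (0 : ℕ → ℤ_[p]) ∈ closure (Set.range φ) := by
    choose U V hUm hVm hUd hVd hU hV hdvd using
      PadicInt.exists_factorization_mod_pow hf hu hv huv h
    refine mem_closure_of_tendsto (b := Filter.atTop)
      (f := fun n ↦ φ ((U n).coeff, (V n).coeff)) ?_
      (Filter.Eventually.of_forall fun n ↦ Set.mem_range_self _)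
    rw [tendsto_pi_nhds]
    intro k
    refine squeeze_zero_norm (a := fun n : ℕ ↦ ((p : ℝ)⁻¹) ^ (n + 1)) (fun n ↦ ?_) ?_
    · have hUP : P u.natDegree (U n).coeff = U n := by
        rw [← hUd n]; exact (hUm n).as_sum.symm
      have hVP : P v.natDegree (V n).coeff = V n := by
        rw [← hVd n]; exact (hVm n).as_sum.symm
      simp only [φ, hUP, hVP]
      obtain ⟨c, hc⟩ := C_dvd_iff_dvd_coeff _ _ |>.mp (hdvd n) k
      rw [hc, norm_mul, norm_pow, PadicInt.norm_p]
      exact mul_le_of_le_one_right (by positivity) (PadicInt.norm_le_one c)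
    · refine (tendsto_pow_atTop_nhds_zero_of_lt_one (by positivity) ?_).comp
        (Filter.tendsto_add_atTop_nat 1)
      exact inv_lt_one_of_one_lt₀ (by exact_mod_cast (Fact.out : p.Prime).one_lt)
  rw [(isCompact_range hφ).isClosed.closure_eq] at hmem
  obtain ⟨c, hc⟩ := hmem
  refine ⟨_, _, hP _ c.1, hP _ c.2, sub_eq_zero.mp ?_⟩
  ext k
  exact congrFun hc k

theorem PadicInt.not_irreducible_map_of_isCoprime {p : ℕ} [Fact p.Prime] {f : ℤ_[p][X]}
    (hf : f.Monic) {u v : (ZMod p)[X]} (hu : u.Monic) (hv : v.Monic) (huv : IsCoprime u v)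
    (h : f.map PadicInt.toZMod = u * v) (hu0 : u.natDegree ≠ 0) (hv0 : v.natDegree ≠ 0) :
    ¬ Irreducible (f.map (algebraMap ℤ_[p] ℚ_[p])) := by
  obtain ⟨U, V, hU, hV, rfl⟩ := PadicInt.exists_factorization_of_isCoprime hf hu hv huv h
  have hinj : Function.Injective (algebraMap ℤ_[p] ℚ_[p]) := IsFractionRing.injective _ _
  intro hirr
  rw [Polynomial.map_mul] at hirr
  rcases hirr.isUnit_or_isUnit rfl with h' | h'
  · apply hu0
    rw [← hU, ← natDegree_map_eq_of_injective hinj]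
    exact natDegree_eq_zero_of_isUnit h'
  · apply hv0
    rw [← hV, ← natDegree_map_eq_of_injective hinj]
    exact natDegree_eq_zero_of_isUnit h'

theorem Polynomial.Monic.abs_coeff_zero_le_of_roots_pow_le {U : ℤ[X]} (hU : U.Monic)
    (hN : U.natDegree ≠ 0) {B : ℝ} (hB : 0 ≤ B)
    (h : ∀ z : ℂ, aeval z U = 0 → ‖z‖ ^ U.natDegree ≤ B) : |(U.coeff 0 : ℝ)| ≤ B := by
  have key := coeff_le_of_roots_le (p := U.map (Int.castRingHom ℂ)) (f := RingHom.id ℂ)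
    (B := B ^ ((U.natDegree : ℝ)⁻¹)) 0 (hU.map _) (IsAlgClosed.splits _) (fun z hz ↦ ?_)
  · rw [hU.natDegree_map, Nat.choose_zero_right, Nat.sub_zero, Real.rpow_inv_natCast_pow hB hN,
      Nat.cast_one, mul_one, Polynomial.map_id, coeff_map] at key
    simpa using key
  · rw [Polynomial.map_id, mem_roots', IsRoot.def, eval_map] at hz
    rw [← pow_le_pow_iff_left₀ (norm_nonneg z) (by positivity) hN,
      Real.rpow_inv_natCast_pow hB hN]
    exact h z hz.2

theorem Complex.norm_pow_le_three_of_trinomial {q N : ℕ} (hq : 2 ≤ q) {A s z : ℂ}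
    (hA : ‖A‖ ≤ 2) (hs : ‖s‖ ≤ 1) (hz : z ^ (q * N) + A * z ^ N + s = 0) : ‖z‖ ^ N ≤ 3 := by
  set t := ‖z‖ ^ N with ht
  have ht0 : 0 ≤ t := by positivity
  have h1 : t ^ q ≤ 2 * t + 1 := by
    have : z ^ (q * N) = -(A * z ^ N + s) := by linear_combination hz
    calc t ^ q = ‖z ^ (q * N)‖ := by rw [norm_pow, ht, ← pow_mul, mul_comm]
      _ = ‖A * z ^ N + s‖ := by rw [this, norm_neg]
      _ ≤ ‖A‖ * ‖z‖ ^ N + ‖s‖ := by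
        refine (norm_add_le _ _).trans ?_
        rw [norm_mul, norm_pow]
      _ ≤ 2 * t + 1 := by gcongr
  by_contra! h3
  have h2 : t ^ 2 ≤ t ^ q := pow_le_pow_right₀ (by linarith) hq
  nlinarith

section trinomial

variable {R : Type*} [CommRing R] {M N : ℕ} (c a d : R)

theorem Polynomial.coeff_zero_trinomial_eq (hN : N ≠ 0) (hNM : N < M) :
    (C c * X ^ M + C a * X ^ N + C d).coeff 0 = d := by
  simp only [coeff_add, coeff_C_mul, coeff_X_pow, coeff_C_zero]
  rw [if_neg hN.symm, if_neg (by omega)]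
  ring

theorem Polynomial.coeff_middle_trinomial_eq (hN : N ≠ 0) (hNM : N < M) :
    (C c * X ^ M + C a * X ^ N + C d).coeff N = a := by
  simp only [coeff_add, coeff_C_mul, coeff_X_pow, coeff_C_of_ne_zero hN]
  rw [if_neg hNM.ne, if_pos trivial]
  ring

theorem Polynomial.coeff_top_trinomial_eq (hNM : N < M) :
    (C c * X ^ M + C a * X ^ N + C d).coeff M = c := by
  simp only [coeff_add, coeff_C_mul, coeff_X_pow, coeff_C_of_ne_zero (Nat.ne_zero_of_lt hNM)]
  rw [if_neg hNM.ne', if_pos trivial]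
  ring

theorem Polynomial.natDegree_trinomial_eq (hNM : N < M) (hc : c ≠ 0) :
    (C c * X ^ M + C a * X ^ N + C d).natDegree = M := by
  apply natDegree_eq_of_le_of_coeff_ne_zero
  · compute_degree
    exact max_le le_rfl hNM.le
  · rwa [coeff_top_trinomial_eq c a d hNM]

end trinomial

/-- The factor of an integral trinomial `ℓ x^(qN) + a x^N ± ℓ` which does not vanish at `0`
modulo `ℓ` is constant. -/
theorem Polynomial.natDegree_eq_zero_of_trinomial_eq_mul {l q N : ℕ} (hl : l.Prime) (hl3 : 3 < l)
    (hq : 2 ≤ q) (hN : N ≠ 0) {a s : ℤ} (hal : ¬ (l : ℤ) ∣ a) (ha : |a| ≤ 2 * l)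
    (hs : |s| = 1) {U V : ℤ[X]}
    (h : C (l : ℤ) * X ^ (q * N) + C a * X ^ N + C (s * l) = U * V)
    (hU0 : (l : ℤ) ∣ U.coeff 0) : V.natDegree = 0 := by
  have : Fact l.Prime := ⟨hl⟩
  have hlZ : Prime (l : ℤ) := Nat.prime_iff_prime_int.mp hl
  have hNq : N < q * N := by nlinarith [Nat.pos_of_ne_zero hN]
  have hc0 : U.coeff 0 * V.coeff 0 = s * l := by
    rw [← mul_coeff_zero, ← h, coeff_zero_trinomial_eq _ _ _ hN hNq]
  have hlc : U.leadingCoeff * V.leadingCoeff = l := by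
    rw [← leadingCoeff_mul, ← h, leadingCoeff,
      natDegree_trinomial_eq _ _ _ hNq hlZ.ne_zero, coeff_top_trinomial_eq _ _ _ hNq]
  have hV0 : ¬ (l : ℤ) ∣ V.coeff 0 := fun hdvd ↦ by
    have h2 : (l : ℤ) * l ∣ s * l := hc0 ▸ mul_dvd_mul hU0 hdvd
    have h3 : (l : ℤ) ∣ s := (mul_dvd_mul_iff_right hlZ.ne_zero).mp h2
    rw [← dvd_abs, hs] at h3
    exact hlZ.not_isUnit (isUnit_of_dvd_one h3)
  set φ := Int.castRingHom (ZMod l)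
  have hφ : ∀ x : ℤ, φ x = 0 ↔ (l : ℤ) ∣ x := fun x ↦ ZMod.intCast_zmod_eq_zero_iff_dvd x l
  have hmod : U.map φ * V.map φ = C (φ a) * X ^ N := by
    rw [← Polynomial.map_mul, ← h]
    have hl0 : φ l = 0 := (hφ _).mpr dvd_rfl
    simp only [Polynomial.map_add, Polynomial.map_mul, map_C, Polynomial.map_pow, map_X, map_mul,
      hl0]
    simp
  have hUdvd : X ^ N ∣ U.map φ := by
    have hcop : IsCoprime (X ^ N) (V.map φ) := by
      apply IsCoprime.pow_left
      rw [irreducible_X.coprime_iff_not_dvd, X_dvd_iff, coeff_map, hφ]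
      exact hV0
    exact hcop.dvd_of_dvd_mul_right (hmod ▸ dvd_mul_left _ _)
  have ha0 : φ a ≠ 0 := fun h0 ↦ hal ((hφ a).mp h0)
  have hne : U.map φ * V.map φ ≠ 0 := by
    rw [hmod]
    exact mul_ne_zero (C_ne_zero.mpr ha0) (pow_ne_zero _ X_ne_zero)
  have hsum : (U.map φ).natDegree + (V.map φ).natDegree = N := by
    rw [← natDegree_mul (left_ne_zero_of_mul hne) (right_ne_zero_of_mul hne), hmod,
      natDegree_C_mul_X_pow _ _ ha0]
  have hNle : N ≤ (U.map φ).natDegree := by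
    simpa using natDegree_le_of_dvd hUdvd (left_ne_zero_of_mul hne)
  by_contra hVdeg
  have hVlc : (l : ℤ) ∣ V.leadingCoeff := by
    rw [← hφ]
    by_contra h0
    rw [← natDegree_map_of_leadingCoeff_ne_zero φ h0] at hVdeg
    omega
  have hUlc : IsUnit U.leadingCoeff := by
    obtain ⟨c, hc⟩ := hVlc
    refine IsUnit.of_mul_eq_one c (mul_right_cancel₀ hlZ.ne_zero ?_)
    rw [one_mul]
    linear_combination hlc - U.leadingCoeff * hc
  have hUdeg : U.natDegree = N := by
    rw [← natDegree_map_of_leadingCoeff_ne_zero φ (hUlc.map φ).ne_zero]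
    omega
  have hroot : ∀ z : ℂ, aeval z U = 0 → ‖z‖ ^ N ≤ 3 := fun z hz ↦ by
    have hlC : (l : ℂ) ≠ 0 := Nat.cast_ne_zero.mpr hl.ne_zero
    refine Complex.norm_pow_le_three_of_trinomial hq (A := a / l) (s := s) (z := z) ?_ ?_ ?_
    · rw [norm_div, Complex.norm_intCast, Complex.norm_natCast, div_le_iff₀ (by positivity)]
      exact_mod_cast ha
    · rw [Complex.norm_intCast]
      exact_mod_cast hs.le
    · have := congrArg (aeval z) h
      rw [map_mul (aeval z) U V, hz, zero_mul] at this
      simp only [map_add, map_mul, map_pow, aeval_X, eq_intCast, map_intCast, map_natCast] at this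
      field_simp
      linear_combination this
  have hbound : |(U.coeff 0 : ℝ)| ≤ 3 := by
    rcases Int.isUnit_iff.mp hUlc with h1 | h1
    · exact Monic.abs_coeff_zero_le_of_roots_pow_le h1 (hUdeg ▸ hN) (by norm_num)
        (hUdeg.symm ▸ hroot)
    · have hm : (-U).Monic := by rw [Monic, leadingCoeff_neg, h1, neg_neg]
      have := hm.abs_coeff_zero_le_of_roots_pow_le (B := 3) (by rwa [natDegree_neg, hUdeg])
        (by norm_num) (fun z hz ↦ by
          rw [natDegree_neg, hUdeg]
          exact hroot z (by simpa using hz))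
      simpa using this
  have hbound' : |U.coeff 0| ≤ 3 := by exact_mod_cast hbound
  have hU0ne : U.coeff 0 ≠ 0 := fun h0 ↦ by
    rw [h0, zero_mul] at hc0
    rcases mul_eq_zero.mp hc0.symm with h1 | h1
    · simp [h1] at hs
    · exact hlZ.ne_zero h1
  have := Int.le_of_dvd (abs_pos.mpr hU0ne) ((dvd_abs _ _).mpr hU0)
  omega

theorem Polynomial.irreducible_trinomial_rat {l q N : ℕ} (hl : l.Prime) (hl3 : 3 < l)
    (hq : 2 ≤ q) (hN : N ≠ 0) {a s : ℤ} (hal : ¬ (l : ℤ) ∣ a) (ha : |a| ≤ 2 * l)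
    (hs : |s| = 1) :
    Irreducible (X ^ (q * N) + C (a / l : ℚ) * X ^ N + C (s : ℚ)) := by
  have hlZ : Prime (l : ℤ) := Nat.prime_iff_prime_int.mp hl
  have hNq : N < q * N := by nlinarith [Nat.pos_of_ne_zero hN]
  set F : ℤ[X] := C (l : ℤ) * X ^ (q * N) + C a * X ^ N + C (s * l) with hF
  have hdeg : F.natDegree = q * N := natDegree_trinomial_eq _ _ _ hNq hlZ.ne_zero
  have hprim : F.IsPrimitive := by
    intro r hr
    rw [C_dvd_iff_dvd_coeff] at hr
    have h1 : r ∣ l := by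
      simpa only [hF, coeff_top_trinomial_eq _ _ _ hNq] using hr (q * N)
    have h2 : r ∣ a := by
      simpa only [hF, coeff_middle_trinomial_eq _ _ _ hN hNq] using hr N
    exact ((hlZ.irreducible.coprime_iff_not_dvd).mpr hal).isUnit_of_dvd' h1 h2
  have hunit : ∀ {V : ℤ[X]}, V ∣ F → V.natDegree = 0 → IsUnit V := fun {V} hV h0 ↦ by
    rw [eq_C_of_natDegree_eq_zero h0] at hV ⊢
    exact isUnit_C.mpr (hprim _ hV)
  have hirr : Irreducible F := by
    refine ⟨fun hu ↦ ?_, fun U V hUV ↦ ?_⟩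
    · have := natDegree_eq_zero_of_isUnit hu
      omega
    · have hc0 : U.coeff 0 * V.coeff 0 = s * l := by
        rw [← mul_coeff_zero, ← hUV, hF, coeff_zero_trinomial_eq _ _ _ hN hNq]
      rcases hlZ.dvd_or_dvd (Dvd.intro_left s hc0.symm) with h0 | h0
      · exact .inr <| hunit (hUV ▸ dvd_mul_left _ _)
          (natDegree_eq_zero_of_trinomial_eq_mul hl hl3 hq hN hal ha hs hUV h0)
      · exact .inl <| hunit (hUV ▸ dvd_mul_right _ _)
          (natDegree_eq_zero_of_trinomial_eq_mul hl hl3 hq hN hal ha hs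
            (hUV.trans (mul_comm U V)) h0)
  have hlQ : (l : ℚ) ≠ 0 := Nat.cast_ne_zero.mpr hl.ne_zero
  rw [IsPrimitive.Int.irreducible_iff_irreducible_map_cast hprim] at hirr
  rw [← irreducible_isUnit_mul (x := C (l : ℚ)) (isUnit_C.mpr hlQ.isUnit)]
  convert hirr using 1
  simp only [hF, Polynomial.map_add, Polynomial.map_mul, map_C, Polynomial.map_pow, map_X, map_mul,
    mul_add, ← mul_assoc]
  simp only [eq_intCast, Int.cast_natCast, ← C_mul, mul_div_cancel₀ _ hlQ]
  rw [mul_comm (s : ℚ)]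

theorem Nat.Prime.dvd_sub_one_of_dvd_pow_sub_one {b p q : ℕ} (hb : b.Prime) (hq : q.Prime)
    (hbq : b ≤ q) (hp : p ≠ 0) (h : b ∣ p ^ q - 1) : b ∣ p - 1 := by
  have : Fact b.Prime := ⟨hb⟩
  have h1 : (p : ZMod b) ^ q = 1 := by
    rw [← ZMod.natCast_eq_zero_iff, Nat.cast_sub (Nat.one_le_pow _ _ (by omega))] at h
    push_cast at h
    exact sub_eq_zero.mp h
  have hp0 : (p : ZMod b) ≠ 0 := fun h0 ↦ by
    rw [h0, zero_pow hq.ne_zero] at h1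
    exact zero_ne_one h1
  have h2 : (p : ZMod b) ^ (b - 1) = 1 := ZMod.pow_card_sub_one_eq_one hp0
  have hcop : q.Coprime (b - 1) := (Nat.Prime.coprime_iff_not_dvd hq).mpr fun hd ↦ by
    have := Nat.le_of_dvd (by have := hb.two_le; omega) hd
    have := hb.two_le
    omega
  have h3 : orderOf (p : ZMod b) ∣ 1 := hcop ▸
    Nat.dvd_gcd (orderOf_dvd_of_pow_eq_one h1) (orderOf_dvd_of_pow_eq_one h2)
  rw [Nat.dvd_one, orderOf_eq_one_iff] at h3
  rw [← ZMod.natCast_eq_zero_iff, Nat.cast_sub (by omega), h3, Nat.cast_one, sub_self]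

theorem IsCyclic.exists_pow_eq_of_pow_card_div_eq_one {G : Type*} [Group G] [Finite G] [IsCyclic G]
    {b : ℕ} (hb : b ∣ Nat.card G) {x : G} (hx : x ^ (Nat.card G / b) = 1) : ∃ y, y ^ b = x := by
  obtain ⟨g, hg⟩ := IsCyclic.exists_generator (α := G)
  obtain ⟨j, rfl⟩ := mem_powers_iff_mem_zpowers.mpr (hg x)
  obtain ⟨c, hc⟩ := hb
  have hpos : 0 < b * c := hc ▸ Nat.card_pos
  have hb0 : 0 < b := Nat.pos_of_mul_pos_right hpos
  have hc0 : 0 < c := Nat.pos_of_mul_pos_left hpos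
  simp only at hx
  rw [hc, Nat.mul_div_cancel_left _ hb0, ← pow_mul, ← orderOf_dvd_iff_pow_eq_one,
    orderOf_eq_card_of_forall_mem_zpowers hg, hc] at hx
  obtain ⟨i, rfl⟩ := Nat.dvd_of_mul_dvd_mul_right hc0 hx
  exact ⟨g ^ i, by simp only; rw [← pow_mul, mul_comm]⟩

theorem FiniteField.exists_pow_eq_of_norm_eq_one {p b q : ℕ} [Fact p.Prime] (hb : b.Prime)
    (hq : q.Prime) (hbq : b ≤ q) {K : Type*} [Field K] [Finite K] [Algebra (ZMod p) K]
    (hK : Nat.card K = p ^ q) {x : K} (hx : Algebra.norm (ZMod p) x = 1) : ∃ y, y ^ b = x := by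
  have hp : p.Prime := Fact.out
  have hx0 : x ≠ 0 := by
    rintro rfl
    rw [Algebra.norm_zero] at hx
    exact zero_ne_one hx
  have hpow := FiniteField.algebraMap_norm_eq_pow (K := ZMod p) (x := x)
  rw [hx, map_one, hK, Nat.card_zmod] at hpow
  obtain ⟨T, hT⟩ : p - 1 ∣ p ^ q - 1 := by simpa using Nat.sub_dvd_pow_sub_pow p 1 q
  have hp1 : 0 < p - 1 := by have := hp.two_le; omega
  rw [hT, Nat.mul_div_cancel_left _ hp1] at hpow
  by_cases hbT : b ∣ T
  · obtain ⟨e, he⟩ := hb.dvd_sub_one_of_dvd_pow_sub_one hq hbq hp.ne_zero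
      (hT ▸ hbT.mul_left _)
    have hcard : Nat.card Kˣ = b * (e * T) := by
      rw [Nat.card_units, hK, hT, he, mul_assoc]
    obtain ⟨y, hy⟩ := IsCyclic.exists_pow_eq_of_pow_card_div_eq_one (G := Kˣ)
      (x := Units.mk0 x hx0) (hcard ▸ dvd_mul_right _ _) (by
        rw [hcard, Nat.mul_div_cancel_left _ hb.pos]
        ext
        simp [mul_comm e, pow_mul, ← hpow])
    exact ⟨y, by simpa using congrArg Units.val hy⟩
  · have hcop : b.Coprime (orderOf x) :=
      ((Nat.Prime.coprime_iff_not_dvd hb).mpr hbT).coprime_dvd_right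
        (orderOf_dvd_of_pow_eq_one hpow.symm)
    obtain ⟨m, hm⟩ := exists_pow_eq_self_of_coprime hcop
    exact ⟨x ^ m, by rw [← hm, ← pow_mul, ← pow_mul, ← pow_mul, mul_comm m]; simp [pow_mul, hm]⟩

theorem ZMod.exists_coprime_factorization_expand {p b q : ℕ} [Fact p.Prime] (hb : b.Prime)
    (hq : q.Prime) (hbq : b ≤ q) (hpb : p ≠ b) {g : (ZMod p)[X]} (hg : g.Monic)
    (hgq : g.natDegree = q) (hirr : Irreducible g) (hg0 : g.coeff 0 = (-1) ^ q) :
    ∃ u v : (ZMod p)[X], u.Monic ∧ v.Monic ∧ IsCoprime u v ∧ u.natDegree ≠ 0 ∧ v.natDegree ≠ 0 ∧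
      expand (ZMod p) b g = u * v := by
  have : Fact (Irreducible g) := ⟨hirr⟩
  have hp : p.Prime := Fact.out
  let K := AdjoinRoot g
  let pb := AdjoinRoot.powerBasis hg.ne_zero
  have : Module.Finite (ZMod p) K := pb.finite
  have : Finite K := Module.finite_of_finite (ZMod p)
  have hrank : Module.finrank (ZMod p) K = q := by
    rw [pb.finrank, AdjoinRoot.powerBasis_dim, hgq]
  have hcard : Nat.card K = p ^ q := by
    rw [Module.natCard_eq_pow_finrank (K := ZMod p), Nat.card_zmod, hrank]
  set β : K := AdjoinRoot.root g
  have hminβ : minpoly (ZMod p) β = g := by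
    rw [AdjoinRoot.minpoly_root hg.ne_zero, hg.leadingCoeff]
    simp
  have hnorm : Algebra.norm (ZMod p) β = 1 := by
    have := Algebra.PowerBasis.norm_gen_eq_coeff_zero_minpoly pb
    rw [AdjoinRoot.powerBasis_gen, AdjoinRoot.powerBasis_dim, hminβ, hg0, hgq, ← mul_pow] at this
    simpa using this
  obtain ⟨η, hη⟩ := FiniteField.exists_pow_eq_of_norm_eq_one hb hq hbq hcard hnorm
  have hηint : IsIntegral (ZMod p) η := Algebra.IsIntegral.isIntegral η
  set h := minpoly (ZMod p) η
  have hm : h.Monic := minpoly.monic hηint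
  have hhirr : Irreducible h := minpoly.irreducible hηint
  have hroot : ∀ f : (ZMod p)[X], aeval η (expand (ZMod p) b f) = aeval β f := fun f ↦ by
    rw [expand_aeval, hη]
  have hβ : aeval β g = 0 := by
    rw [AdjoinRoot.aeval_eq, AdjoinRoot.mk_self]
  obtain ⟨w, hw⟩ : h ∣ expand (ZMod p) b g := minpoly.dvd _ _ (by rw [hroot, hβ])
  have hexp : (expand (ZMod p) b g).Monic := hg.expand hb.pos
  have hwm : w.Monic := hm.of_mul_monic_left (hw ▸ hexp)
  have hdeg : h.natDegree ≤ q := hrank ▸ minpoly.natDegree_le η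
  have hsum : h.natDegree + w.natDegree = q * b := by
    rw [← hm.natDegree_mul hwm, ← hw, natDegree_expand, hgq]
  have hβ0 : β ≠ 0 := by
    intro h0
    rw [h0, Algebra.norm_zero] at hnorm
    exact zero_ne_one hnorm
  have hη0 : η ≠ 0 := by
    rintro rfl
    exact hβ0 (by rw [← hη, zero_pow hb.ne_zero])
  refine ⟨h, w, hm, hwm, ?_, hhirr.natDegree_pos.ne', ?_, hw⟩
  · rw [hhirr.coprime_iff_not_dvd]
    rintro ⟨r, rfl⟩
    have hsep : g.Separable := PerfectField.separable_of_irreducible hirr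
    have hder := congrArg (fun f ↦ aeval η (derivative f)) hw
    simp only [derivative_expand, derivative_mul, map_mul, map_add, hroot, map_pow, aeval_X,
      map_natCast, h, minpoly.aeval, zero_mul, mul_zero, add_zero] at hder
    have hbK : (b : K) ≠ 0 := by
      rw [← map_natCast (algebraMap (ZMod p) K), _root_.map_ne_zero, Ne, ZMod.natCast_eq_zero_iff]
      exact fun hd ↦ hpb ((Nat.prime_dvd_prime_iff_eq hp hb).mp hd)
    exact mul_ne_zero (hsep.aeval_derivative_ne_zero hβ)
      (mul_ne_zero hbK (pow_ne_zero _ hη0)) hder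
  · have := hb.two_le
    have := hq.pos
    nlinarith

theorem Polynomial.exists_coprime_factorization_or_eq_pow {k : Type*} [Field k] {g : k[X]}
    (hg : g.Monic) (hq : g.natDegree.Prime) (hirr : ¬ Irreducible g) :
    (∃ u v : k[X], u.Monic ∧ v.Monic ∧ IsCoprime u v ∧ u.natDegree ≠ 0 ∧ v.natDegree ≠ 0 ∧
      g = u * v) ∨ ∃ c : k, g = (X - C c) ^ g.natDegree := by
  obtain ⟨π, hπ, hπi, hπg⟩ := exists_monic_irreducible_factor g fun hu ↦
    hq.ne_zero (natDegree_eq_zero_of_isUnit hu)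
  obtain ⟨w, hw, hπw⟩ := (FiniteMultiplicity.of_prime_left hπi.prime
    hg.ne_zero).exists_eq_pow_mul_and_not_dvd
  set e := multiplicity π g
  have hwm : w.Monic := (hπ.pow e).of_mul_monic_left (hw ▸ hg)
  have he : e ≠ 0 := by
    intro h0
    rw [h0, pow_zero, one_mul] at hw
    exact hπw (hw ▸ hπg)
  have hπd := hπi.natDegree_pos
  by_cases hwd : w.natDegree = 0
  · rw [hwm.natDegree_eq_zero.mp hwd, mul_one] at hw
    have hdeg : g.natDegree = e * π.natDegree := by
      conv_lhs => rw [hw, natDegree_pow]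
    have hd1 : π.natDegree = 1 := by
      refine (hq.eq_one_or_self_of_dvd _ (Dvd.intro_left _ hdeg.symm)).resolve_right fun h ↦ hirr ?_
      have he1 : e = 1 := by
        rw [h] at hdeg
        nlinarith
      rwa [hw, he1, pow_one]
    rw [hd1, mul_one] at hdeg
    refine .inr ⟨-π.coeff 0, ?_⟩
    have hπe : π = X - C (-π.coeff 0) := by
      rw [C_neg, sub_neg_eq_add]
      exact hπ.eq_X_add_C hd1
    rw [← hπe, hdeg]
    exact hw
  · refine .inl ⟨π ^ e, w, hπ.pow e, hwm,
      (hπi.coprime_iff_not_dvd.mpr hπw).pow_left, ?_, hwd, hw⟩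
    rw [natDegree_pow]
    exact (Nat.mul_pos (Nat.pos_of_ne_zero he) hπd).ne'

theorem Polynomial.exists_coprime_factorization_X_pow_sub_one_pow {k : Type*} [Field k] {b q : ℕ}
    (hb : 2 ≤ b) (hbk : (b : k) ≠ 0) (hq : q ≠ 0) :
    ∃ u v : k[X], u.Monic ∧ v.Monic ∧ IsCoprime u v ∧ u.natDegree ≠ 0 ∧ v.natDegree ≠ 0 ∧
      (X ^ b - 1 : k[X]) ^ q = u * v := by
  have hw : (∑ i ∈ Finset.range b, X ^ i : k[X]).Monic := monic_geom_sum_X (by omega)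
  have h1 : (X - C 1 : k[X]).Monic := monic_X_sub_C 1
  have hmul : (X - C 1 : k[X]) * ∑ i ∈ Finset.range b, X ^ i = X ^ b - 1 := by
    rw [C_1]
    exact mul_geom_sum X b
  have hsum := h1.natDegree_mul hw
  rw [hmul, natDegree_X_sub_C, ← C_1, natDegree_X_pow_sub_C] at hsum
  refine ⟨_, _, h1.pow q, hw.pow q, IsCoprime.pow ?_, ?_, ?_, ?_⟩
  · rw [(irreducible_X_sub_C (1 : k)).coprime_iff_not_dvd, dvd_iff_isRoot, IsRoot.def]
    simpa [eval_finsetSum] using hbk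
  · rw [natDegree_pow, natDegree_X_sub_C, mul_one]
    exact hq
  · rw [natDegree_pow]
    exact mul_ne_zero hq (by omega)
  · rw [← mul_pow, hmul]

theorem PadicInt.not_irreducible_expand {p b q : ℕ} [Fact p.Prime] (hb : b.Prime)
    (hq : q.Prime) (hbq : b ≤ q) (hpb : p ≠ b) {g : ℤ_[p][X]} (hg : g.Monic)
    (hgq : g.natDegree = q) (hg0 : g.coeff 0 = (-1) ^ q)
    (hpow : ∀ c : ZMod p, g.map PadicInt.toZMod = (X - C c) ^ q → c = 1) :
    ¬ Irreducible (expand ℚ_[p] b (g.map (algebraMap ℤ_[p] ℚ_[p]))) := by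
  have hgd : (g.map PadicInt.toZMod).natDegree = q := (hg.natDegree_map _).trans hgq
  have hexp : (expand (ZMod p) b (g.map PadicInt.toZMod)) =
    (expand ℤ_[p] b g).map PadicInt.toZMod := (map_expand ..).symm
  by_cases hirr : Irreducible (g.map PadicInt.toZMod)
  · obtain ⟨u, v, hu, hv, huv, hu0, hv0, h⟩ := ZMod.exists_coprime_factorization_expand hb hq hbq
      hpb (hg.map _) hgd hirr (by simp [coeff_map, hg0])
    rw [← map_expand]
    exact PadicInt.not_irreducible_map_of_isCoprime (hg.expand hb.pos) hu hv huv (hexp ▸ h) hu0 hv0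
  rcases exists_coprime_factorization_or_eq_pow (hg.map _) (hgd ▸ hq) hirr with
    ⟨u, v, hu, hv, huv, hu0, hv0, h⟩ | ⟨c, hc⟩
  · exact fun hi ↦ PadicInt.not_irreducible_map_of_isCoprime hg hu hv huv h hu0 hv0
      (of_irreducible_expand hb.ne_zero hi)
  · rw [hgd] at hc
    obtain rfl := hpow c hc
    have hbk : (b : ZMod p) ≠ 0 := by
      rw [Ne, ZMod.natCast_eq_zero_iff]
      exact fun hd ↦ hpb ((Nat.prime_dvd_prime_iff_eq Fact.out hb).mp hd)
    obtain ⟨u, v, hu, hv, huv, hu0, hv0, h⟩ :=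
      exists_coprime_factorization_X_pow_sub_one_pow hb.two_le hbk hq.ne_zero
    rw [← map_expand]
    refine PadicInt.not_irreducible_map_of_isCoprime (hg.expand hb.pos) hu hv huv ?_ hu0 hv0
    rw [← hexp, hc, ← h]
    simp

theorem Polynomial.not_irreducible_of_aeval_eq_zero {p : ℕ} [Fact p.Prime] {G : ℚ_[p][X]}
    (hG : 2 ≤ G.natDegree) {F : ℤ_[p][X]} {c : ℚ_[p]} (hF : F.map (algebraMap _ _) = C c * G)
    (hc : c ≠ 0) {z : ℤ_[p]} (hz : aeval z F = 0) : ¬ Irreducible G := by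
  intro hirr
  have hroot : G.IsRoot (z : ℚ_[p]) := by
    have h := congrArg (eval (z : ℚ_[p])) hF
    have h2 : eval (z : ℚ_[p]) (F.map (algebraMap ℤ_[p] ℚ_[p])) = 0 := by
      rw [eval_map]
      change eval₂ _ (algebraMap ℤ_[p] ℚ_[p] z) F = 0
      rw [eval₂_at_apply, ← coe_aeval_eq_eval, hz, map_zero]
    rw [h2, eval_mul, eval_C] at h
    exact (mul_eq_zero.mp h.symm).resolve_left hc
  have : G.natDegree = 1 :=
    natDegree_eq_of_degree_eq_some (degree_eq_one_of_irreducible_of_root hirr hroot)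
  omega

section

variable {R : Type*} [CommRing R] [Nontrivial R] {q : ℕ}

theorem Polynomial.natDegree_X_pow_add_C_mul_X_add_C (hq : 2 ≤ q) (a s : R) :
    (X ^ q + C a * X + C s).natDegree = q := by
  have := natDegree_trinomial_eq (1 : R) a s (N := 1) (M := q) (by omega) one_ne_zero
  simpa using this

theorem Polynomial.monic_X_pow_add_C_mul_X_add_C (hq : 2 ≤ q) (a s : R) :
    (X ^ q + C a * X + C s).Monic := by
  rw [Monic, leadingCoeff, natDegree_X_pow_add_C_mul_X_add_C hq]
  have := coeff_top_trinomial_eq (1 : R) a s (N := 1) (M := q) (by omega)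
  simpa using this

end

section

variable {R : Type*} [CommRing R] (c a s : R) (q : ℕ)

theorem Polynomial.map_C_mul_X_pow_add_C_mul_X_add_C {S : Type*} [CommRing S] (φ : R →+* S) :
    (C c * X ^ q + C a * X + C s).map φ = C (φ c) * X ^ q + C (φ a) * X + C (φ s) := by
  simp only [Polynomial.map_add, Polynomial.map_mul, map_C, Polynomial.map_pow, map_X]

theorem Polynomial.aeval_derivative_C_mul_X_pow_add_C_mul_X_add_C (x : R) :
    aeval x (derivative (C c * X ^ q + C a * X + C s)) = c * (q * x ^ (q - 1)) + a := by
  simp only [derivative_add, derivative_C_mul, derivative_X_pow, derivative_X, derivative_C,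
    coe_aeval_eq_eval, eval_add, eval_mul, eval_C, eval_pow, eval_X, mul_one, add_zero]

end

/-- At a prime `l` dividing exactly the denominator of the middle coefficient, the trinomial has
a root. -/
theorem Padic.not_irreducible_trinomial_of_denom {l q : ℕ} [Fact l.Prime] (hq : 2 ≤ q) {a s : ℤ}
    (hal : ¬ (l : ℤ) ∣ a) :
    ¬ Irreducible (X ^ q + C (a / l : ℚ_[l]) * X + C (s : ℚ_[l])) := by
  have hl : l.Prime := Fact.out
  have hl0 : (l : ℚ_[l]) ≠ 0 := Nat.cast_ne_zero.mpr hl.ne_zero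
  set F : ℤ_[l][X] := C (l : ℤ_[l]) * X ^ q + C (a : ℤ_[l]) * X + C (s * l : ℤ_[l]) with hF
  have h0 : aeval 0 F = (s * l : ℤ_[l]) := by
    simp only [hF, coe_aeval_eq_eval, eval_add, eval_mul, eval_C, eval_pow, eval_X, mul_zero,
      zero_pow (by omega : q ≠ 0), zero_add]
  have h1 : aeval 0 (derivative F) = (a : ℤ_[l]) := by
    rw [hF, aeval_derivative_C_mul_X_pow_add_C_mul_X_add_C, zero_pow (by omega), mul_zero,
      mul_zero, zero_add]
  have ha : ‖(a : ℤ_[l])‖ = 1 := PadicInt.norm_intCast_eq_one_iff.mpr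
    ((Nat.prime_iff_prime_int.mp hl).irreducible.coprime_iff_not_dvd.mpr hal).symm
  obtain ⟨z, hz, -⟩ := hensels_lemma (F := F) (a := 0) (by
    rw [h0, h1, ha, norm_mul, one_pow]
    refine (mul_le_of_le_one_left (norm_nonneg _) (PadicInt.norm_le_one _)).trans_lt ?_
    rw [PadicInt.norm_p]
    exact inv_lt_one_of_one_lt₀ (by exact_mod_cast hl.one_lt))
  refine not_irreducible_of_aeval_eq_zero (c := (l : ℚ_[l])) (F := F) (z := z) ?_ ?_ hl0 hz
  · rw [natDegree_X_pow_add_C_mul_X_add_C hq]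
    exact hq
  · have hmap : algebraMap ℤ_[l] ℚ_[l] (s * l) = l * s := by
      rw [map_mul, map_intCast, map_natCast, mul_comm]
    rw [hF, map_C_mul_X_pow_add_C_mul_X_add_C, hmap, map_natCast, map_intCast, mul_add, mul_add,
      ← mul_assoc, ← C_mul, ← C_mul, mul_div_cancel₀ _ hl0]

/-- If `‖α‖` is small enough then `x ^ q + α x - 1` has a root near `1`. -/
theorem PadicInt.not_irreducible_trinomial_of_norm_lt {p q : ℕ} [Fact p.Prime] (hq : q.Prime)
    {α : ℤ_[p]} (hα : ‖α‖ ≤ (p : ℝ)⁻¹ ^ 3) :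
    ¬ Irreducible (X ^ q + C (α : ℚ_[p]) * X + C (-1 : ℚ_[p])) := by
  have hp : p.Prime := Fact.out
  set F : ℤ_[p][X] := C 1 * X ^ q + C α * X + C (-1) with hF
  have h0 : aeval 1 F = α := by
    simp [hF]
  have h1 : aeval 1 (derivative F) = q + α := by
    rw [hF, aeval_derivative_C_mul_X_pow_add_C_mul_X_add_C, one_pow, mul_one, one_mul]
  have hpinv : (p : ℝ)⁻¹ < 1 := inv_lt_one_of_one_lt₀ (by exact_mod_cast hp.one_lt)
  have hpinv0 : 0 < (p : ℝ)⁻¹ := by have := hp.pos; positivity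
  have hqn : (p : ℝ)⁻¹ ≤ ‖(q : ℤ_[p])‖ := by
    by_cases hpq : p = q
    · subst hpq
      rw [PadicInt.norm_p]
    · rw [PadicInt.norm_natCast_eq_one_iff.mpr ((Nat.coprime_primes hp hq).mpr hpq)]
      exact hpinv.le
  have hlt : ‖α‖ < ‖(q : ℤ_[p])‖ ^ 2 :=
    (hα.trans_lt (pow_lt_pow_right_of_lt_one₀ hpinv0 hpinv (by norm_num : 2 < 3))).trans_le
      (by gcongr)
  have hlt' : ‖α‖ < ‖(q : ℤ_[p])‖ :=
    hlt.trans_le (pow_le_of_le_one (norm_nonneg _) (PadicInt.norm_le_one _) two_ne_zero)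
  obtain ⟨z, hz, -⟩ := hensels_lemma (F := F) (a := 1) (by
    rwa [h0, h1, PadicInt.norm_add_eq_max_of_ne hlt'.ne', max_eq_left hlt'.le])
  refine not_irreducible_of_aeval_eq_zero (c := 1) (F := F) (z := z) ?_ ?_ one_ne_zero hz
  · rw [natDegree_X_pow_add_C_mul_X_add_C hq.two_le]
    exact hq.two_le
  · have hmap : algebraMap ℤ_[p] ℚ_[p] (-1) = -1 := by rw [map_neg, map_one]
    rw [hF, map_C_mul_X_pow_add_C_mul_X_add_C, hmap, map_one, C_1, one_mul, one_mul]
    rfl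

theorem PadicInt.exists_coe_eq_div {p l : ℕ} [Fact p.Prime] (hl : l.Prime) (hpl : p ≠ l) (a : ℤ) :
    ∃ α : ℤ_[p], α * l = a ∧ (α : ℚ_[p]) = a / l := by
  have hp : p.Prime := Fact.out
  obtain ⟨u, hu⟩ := PadicInt.isUnit_iff.mpr
    (PadicInt.norm_natCast_eq_one_iff.mpr ((Nat.coprime_primes hp hl).mpr hpl))
  have h : (a * ↑u⁻¹ : ℤ_[p]) * l = a := by
    rw [← hu, mul_assoc, Units.inv_mul, mul_one]
  refine ⟨a * ↑u⁻¹, h, ?_⟩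
  rw [eq_div_iff (Nat.cast_ne_zero.mpr hl.ne_zero)]
  exact_mod_cast congrArg (fun x : ℤ_[p] ↦ (x : ℚ_[p])) h

theorem PadicInt.not_irreducible_expand_trinomial {p b q : ℕ} [Fact p.Prime] (hb : b.Prime)
    (hq : q.Prime) (hbq : b ≤ q) (hpb : p ≠ b) {α : ℤ_[p]}
    (hpow : ∀ c : ZMod p,
      X ^ q + C (PadicInt.toZMod α) * X + C ((-1) ^ q) = (X - C c) ^ q → c = 1) :
    ¬ Irreducible (expand ℚ_[p] b (X ^ q + C (α : ℚ_[p]) * X + C ((-1) ^ q : ℚ_[p]))) := by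
  have hmap : ∀ {S : Type} [CommRing S] (φ : ℤ_[p] →+* S),
      (X ^ q + C α * X + C ((-1) ^ q)).map φ = X ^ q + C (φ α) * X + C ((-1) ^ q) := by
    intro S _ φ
    have hs : φ ((-1) ^ q) = (-1) ^ q := by rw [map_pow, map_neg, map_one]
    simpa only [map_one, C_1, one_mul, hs] using
      map_C_mul_X_pow_add_C_mul_X_add_C 1 α ((-1) ^ q) q φ
  have := PadicInt.not_irreducible_expand hb hq hbq hpb
    (monic_X_pow_add_C_mul_X_add_C hq.two_le α ((-1) ^ q))
    (natDegree_X_pow_add_C_mul_X_add_C hq.two_le α ((-1) ^ q))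
    (by rw [coeff_add, coeff_add, coeff_C_zero, coeff_mul_X_zero, coeff_X_pow,
      if_neg hq.ne_zero.symm, zero_add, zero_add]) (fun c hc ↦ hpow c (by rw [← hc, hmap]))
  rwa [hmap] at this

/-- A trinomial with nonzero linear coefficient is a `q`-th power of a linear polynomial only
for `q ≤ 2`. -/
theorem Polynomial.X_pow_add_C_mul_X_add_C_ne_pow {k : Type*} [Field k] {q : ℕ} (hq : 2 < q)
    {a s : k} (ha : a ≠ 0) (c : k) : X ^ q + C a * X + C s ≠ (X - C c) ^ q := by
  intro h
  rw [sub_eq_add_neg, ← C_neg] at h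
  have h1 := congrArg (fun f ↦ f.coeff 1) h
  have h2 := congrArg (fun f ↦ f.coeff (q - 1)) h
  simp only [coeff_X_add_C_pow, coeff_add, coeff_C_mul, coeff_X_pow, coeff_C,
    coeff_X, Nat.choose_one_right] at h1 h2
  rw [if_neg (by omega : ¬ 1 = q), if_pos trivial, if_neg one_ne_zero, mul_one, zero_add,
    add_zero] at h1
  rw [if_neg (by omega : ¬ q - 1 = q), if_neg (by omega : ¬ 1 = q - 1),
    if_neg (by omega : ¬ q - 1 = 0), mul_zero, Nat.sub_sub_self (by omega), pow_one,
    Nat.choose_symm (by omega), Nat.choose_one_right, add_zero, add_zero] at h2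
  rcases mul_eq_zero.mp h2.symm with h0 | h0
  · rw [h0, zero_pow (by omega), zero_mul] at h1
    exact ha h1
  · rw [h0, mul_zero] at h1
    exact ha h1

theorem Padic.not_irreducible_trinomial_of_odd {p b q l : ℕ} [Fact p.Prime] (hb : b.Prime)
    (hq : q.Prime) (hbq : b ≤ q) (hq2 : 2 < q) (hl : l.Prime) (hbl : b ^ 3 < l) :
    ¬ Irreducible (expand ℚ_[p] b
      (X ^ q + C (((b : ℤ) ^ 3 : ℤ) / l : ℚ_[p]) * X + C ((-1) ^ q : ℚ_[p]))) := by
  have hp : p.Prime := Fact.out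
  have hodd : (-1 : ℚ_[p]) ^ q = -1 := (hq.odd_of_ne_two hq2.ne').neg_one_pow
  by_cases hpl : p = l
  · subst hpl
    have hs : ((-1 : ℤ) : ℚ_[p]) = (-1) ^ q := by
      rw [hodd, Int.cast_neg, Int.cast_one]
    refine fun h ↦ Padic.not_irreducible_trinomial_of_denom (l := p) (a := (b : ℤ) ^ 3) (s := -1)
      hq.two_le (fun hd ↦ ?_) (hs ▸ of_irreducible_expand hb.ne_zero h)
    have := Nat.le_of_dvd (pow_pos hb.pos 3) (by exact_mod_cast hd)
    omega
  obtain ⟨α, hα, hαc⟩ := PadicInt.exists_coe_eq_div hl hpl ((b : ℤ) ^ 3)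
  rw [← hαc]
  by_cases hpb : p = b
  · subst hpb
    rw [hodd]
    refine fun h ↦ PadicInt.not_irreducible_trinomial_of_norm_lt hq ?_
      (of_irreducible_expand hb.ne_zero h)
    have := congrArg norm hα
    rw [norm_mul, PadicInt.norm_natCast_eq_one_iff.mpr ((Nat.coprime_primes hp hl).mpr hpl)] at this
    push_cast at this
    rw [mul_one, norm_pow, PadicInt.norm_p] at this
    exact this.le
  · refine PadicInt.not_irreducible_expand_trinomial hb hq hbq hpb fun c hc ↦ ?_
    refine absurd hc (X_pow_add_C_mul_X_add_C_ne_pow hq2 (fun h0 ↦ ?_) c)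
    have := congrArg PadicInt.toZMod hα
    rw [map_mul, h0, zero_mul] at this
    push_cast at this
    rw [map_pow, map_natCast, eq_comm, pow_eq_zero_iff three_ne_zero, ZMod.natCast_eq_zero_iff,
      Nat.prime_dvd_prime_iff_eq hp hb] at this
    exact hpb this

theorem Padic.not_irreducible_quartic (p : ℕ) [Fact p.Prime] :
    ¬ Irreducible (expand ℚ_[p] 2 (X ^ 2 + C (33 / 17 : ℚ_[p]) * X + C 1)) := by
  have hp : p.Prime := Fact.out
  by_cases hpl : p = 17
  · subst hpl
    refine fun h ↦ Padic.not_irreducible_trinomial_of_denom (l := 17) (a := 33) (s := 1) le_rfl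
      (by norm_num) (of_irreducible_expand two_ne_zero (by simpa using h))
  by_cases hp2 : p = 2
  · subst hp2
    obtain ⟨z, hz, -⟩ := hensels_lemma (p := 2) (F := (X ^ 2 - C 17 : ℤ_[2][X])) (a := 1) (by
      have h16 : (aeval (1 : ℤ_[2]) (X ^ 2 - C 17 : ℤ_[2][X])) = -(2 : ℕ) ^ 4 := by
        simp; norm_num
      have h2 : (aeval (1 : ℤ_[2]) (derivative (X ^ 2 - C 17 : ℤ_[2][X]))) = (2 : ℕ) := by
        simp
        norm_num
      rw [h16, h2, norm_neg, norm_pow, PadicInt.norm_p]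
      norm_num)
    have hz2 : (z : ℚ_[2]) ^ 2 = 17 := by
      have h17 : z ^ 2 = 17 := by simpa [sub_eq_zero] using hz
      exact_mod_cast congrArg (fun x : ℤ_[2] ↦ (x : ℚ_[2])) h17
    have hC : (C (z : ℚ_[2])⁻¹ : ℚ_[2][X]) ^ 2 = C (2 - 33 / 17) := by
      rw [← C_pow, inv_pow, hz2]
      norm_num
    have hfac : expand ℚ_[2] 2 (X ^ 2 + C (33 / 17 : ℚ_[2]) * X + C 1) =
        (X ^ 2 + C (z : ℚ_[2])⁻¹ * X + C 1) * (X ^ 2 + C (-(z : ℚ_[2])⁻¹) * X + C 1) := by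
      simp only [map_add, map_mul, map_pow, expand_X, expand_C, C_neg, C_sub, map_one] at hC ⊢
      have h2 : (C (2 : ℚ_[2]) : ℚ_[2][X]) = 2 := rfl
      rw [h2] at hC
      linear_combination X ^ 2 * hC
    rw [hfac]
    intro hirr
    rcases hirr.isUnit_or_isUnit rfl with h | h
    all_goals
      have := natDegree_eq_zero_of_isUnit h
      rw [natDegree_X_pow_add_C_mul_X_add_C le_rfl] at this
      exact two_ne_zero this
  obtain ⟨α, hα, hαc⟩ := PadicInt.exists_coe_eq_div (p := p) (l := 17) (by norm_num) hpl 33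
  push_cast at hα hαc
  have h := PadicInt.not_irreducible_expand_trinomial (p := p) (α := α) Nat.prime_two Nat.prime_two
    le_rfl hp2 fun c hc ↦ ?_
  · rw [hαc] at h
    simpa using h
  have h0 := congrArg (fun f ↦ f.coeff 0) hc
  have h1 := congrArg (fun f ↦ f.coeff 1) hc
  rw [sub_eq_add_neg, ← C_neg] at h0 h1
  simp only [coeff_X_add_C_pow, coeff_add, coeff_C_mul, coeff_X_pow, coeff_C,
    coeff_X] at h0 h1
  norm_num at h0 h1
  rcases eq_or_eq_neg_of_sq_eq_sq c 1 (by simpa using h0.symm) with hc1 | hc1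
  · exact hc1
  · have h2 := congrArg PadicInt.toZMod hα
    simp only [map_mul, map_ofNat] at h2
    rw [hc1] at h1 ⊢
    linear_combination 34 * h1 - 2 * h2

theorem Polynomial.map_expand_expand_trinomial {K L : Type*} [Field K] [Field L] (φ : K →+* L)
    (a s : K) (q b m : ℕ) :
    (X ^ (q * (b * m)) + C a * X ^ (b * m) + C s).map φ =
      expand L m (expand L b (X ^ q + C (φ a) * X + C (φ s))) := by
  simp only [Polynomial.map_add, Polynomial.map_mul, map_C, Polynomial.map_pow, map_X, map_add,
    map_mul, map_pow, expand_X, expand_C, ← pow_mul]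
  ring_nf

/-- For every composite positive integer `n`, there exists `f ∈ ℚ[x]` of degree `n`,
irreducible over `ℚ`, which is reducible over `ℚ_p` for every prime `p`. -/
theorem stmt_5 (n : ℕ) (hn : 1 < n) (hn' : ¬ n.Prime) :
    ∃ f : Polynomial ℚ, f.natDegree = n ∧ Irreducible f ∧
      ∀ (p : ℕ) [Fact p.Prime], ¬ Irreducible (f.map (algebraMap ℚ ℚ_[p])) := by
  obtain ⟨b, q, m, hb, hq, hbq, hm, rfl⟩ : ∃ b q m : ℕ, b.Prime ∧ q.Prime ∧ b ≤ q ∧ m ≠ 0 ∧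
      n = q * (b * m) := by
    obtain ⟨k, hk⟩ := n.minFac_dvd
    have hb := Nat.minFac_prime hn.ne'
    have hk1 : k ≠ 1 := by
      rintro rfl
      rw [mul_one] at hk
      exact hn' (hk ▸ hb)
    obtain ⟨q, hq, m, rfl⟩ := Nat.exists_prime_and_dvd hk1
    refine ⟨n.minFac, q, m, hb, hq, Nat.minFac_le_of_dvd hq.two_le ⟨n.minFac * m, ?_⟩, ?_, ?_⟩
    · exact hk.trans (by ring)
    · rintro rfl
      simp at hk
      omega
    · exact hk.trans (by ring)
  have hN : b * m ≠ 0 := mul_ne_zero hb.ne_zero hm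
  have hNq : b * m < q * (b * m) := lt_mul_of_one_lt_left (Nat.pos_of_ne_zero hN) hq.one_lt
  have hdeg : ∀ a s : ℚ, (X ^ (q * (b * m)) + C a * X ^ (b * m) + C s).natDegree =
      q * (b * m) := fun a s ↦ by
    simpa only [C_1, one_mul] using natDegree_trinomial_eq 1 a s hNq one_ne_zero
  have hs : |((-1) ^ q : ℤ)| = 1 := by rw [abs_pow, abs_neg, abs_one, one_pow]
  rcases hq.two_le.eq_or_lt with rfl | hq2
  · obtain rfl : b = 2 := le_antisymm hbq hb.two_le
    have hirr := irreducible_trinomial_rat (l := 17) (a := 33) (by norm_num) (by norm_num) le_rfl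
      hN (by norm_num) (by norm_num) hs
    refine ⟨_, hdeg _ _, hirr, fun p _ h ↦ Padic.not_irreducible_quartic p ?_⟩
    rw [map_expand_expand_trinomial] at h
    simpa using of_irreducible_expand hm h
  · obtain ⟨l, hle, hl⟩ := Nat.exists_infinite_primes (b ^ 3 + 4)
    have hb3 : 0 < b ^ 3 := pow_pos hb.pos 3
    have hirr := irreducible_trinomial_rat (a := (b : ℤ) ^ 3) hl (by omega) hq.two_le hN
      (fun hd ↦ by
        have := Nat.le_of_dvd hb3 (by exact_mod_cast hd)
        omega)
      (by
        rw [abs_of_nonneg (by positivity)]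
        exact_mod_cast (by omega : b ^ 3 ≤ 2 * l)) hs
    refine ⟨_, hdeg _ _, hirr, fun p _ h ↦
      Padic.not_irreducible_trinomial_of_odd hb hq hbq hq2 hl (by omega : b ^ 3 < l) (p := p) ?_⟩
    rw [map_expand_expand_trinomial] at h
    simpa using of_irreducible_expand hm h
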